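/- The function r ↦ (E(r) − r'² K(r))² / (E(r)² − r'² K(r)²) is strictly decreasing on (0,1), with limit 2 as r → 0⁺ and limit 1 as r → 1⁻ (so it maps (0,1) onto (1, 2)). -/

import Mathlib

open Real Set Filter Topology

/-- The complete elliptic integral of the second kind. -/
noncomputable def ellipticE (r : ℝ) : ℝ :=
  ∫ θ in (0:ℝ)..(π/2), Real.sqrt (1 - r^2 * Real.sin θ ^ 2)

/-- The complete elliptic integral of the first kind. -/
noncomputable def ellipticK (r : ℝ) : ℝ :=
  ∫ θ in (0:ℝ)..(π/2), (1 - r^2 * Real.sin θ ^ 2) ^ (-(1:ℝ)/2)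

noncomputable def auxJ (p : ℝ) (g : ℝ → ℝ) (x : ℝ) : ℝ :=
  ∫ θ in (0:ℝ)..(π/2), g θ * (1 - x * Real.sin θ ^ 2) ^ p

lemma aux_pos {x : ℝ} (hx : x < 1) (θ : ℝ) : 0 < 1 - x * Real.sin θ ^ 2 := by
  have h1 := Real.sin_sq_le_one θ
  have h2 := sq_nonneg (Real.sin θ)
  rcases le_or_gt x 0 with h | h
  · nlinarith
  · nlinarith

lemma aux_cont {x : ℝ} (hx : x < 1) (p : ℝ) {g : ℝ → ℝ} (hg : Continuous g) :
    Continuous (fun θ => g θ * (1 - x * Real.sin θ ^ 2) ^ p) := by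
  refine hg.mul (Continuous.rpow_const (by fun_prop) ?_)
  intro θ; left; exact (aux_pos hx θ).ne'

lemma aux_int {x : ℝ} (hx : x < 1) (p : ℝ) {g : ℝ → ℝ} (hg : Continuous g) (a b : ℝ) :
    IntervalIntegrable (fun θ => g θ * (1 - x * Real.sin θ ^ 2) ^ p) MeasureTheory.volume a b :=
  (aux_cont hx p hg).intervalIntegrable _ _

lemma auxJ_deriv (p : ℝ) {g : ℝ → ℝ} (hg : Continuous g) {x : ℝ} (hx : x < 1) :
    HasDerivAt (auxJ p g) (-p * auxJ (p-1) (fun θ => g θ * Real.sin θ ^ 2) x) x := by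
  set F' : ℝ → ℝ → ℝ := fun x θ => g θ * (-Real.sin θ ^ 2 * p * (1 - x * Real.sin θ ^ 2) ^ (p-1))
    with hF'
  have hs : Icc (x - (1-x)/2) (x + (1-x)/2) ∈ 𝓝 x :=
    Icc_mem_nhds (by linarith) (by linarith)
  have hlt : ∀ y ∈ Icc (x - (1-x)/2) (x + (1-x)/2), y < 1 := fun y hy => by
    have := hy.2; linarith
  have hc : ContinuousOn (fun q : ℝ × ℝ => F' q.1 q.2)
      (Icc (x - (1-x)/2) (x + (1-x)/2) ×ˢ Icc 0 (π/2)) := by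
    simp only [hF']
    refine ContinuousOn.mul (by fun_prop) (ContinuousOn.mul (by fun_prop) ?_)
    refine ContinuousOn.rpow_const (by fun_prop) ?_
    intro q hq; left; exact (aux_pos (hlt _ hq.1) _).ne'
  obtain ⟨C, hC⟩ := (isCompact_Icc.prod isCompact_Icc).exists_bound_of_continuousOn hc
  have key := intervalIntegral.hasDerivAt_integral_of_dominated_loc_of_deriv_le
    (F := fun x θ => g θ * (1 - x * Real.sin θ ^ 2) ^ p) (F' := F') (x₀ := x)
    (a := 0) (b := π/2) (μ := MeasureTheory.volume) (bound := fun _ => C) hs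
    (by
      filter_upwards [hs] with y hy
      exact (aux_cont (hlt y hy) p hg).aestronglyMeasurable)
    (aux_int hx p hg _ _)
    (by
      have : Continuous (F' x) := by
        refine hg.mul (Continuous.mul (by fun_prop) (Continuous.rpow_const (by fun_prop) ?_))
        intro θ; left; exact (aux_pos hx θ).ne'
      exact this.aestronglyMeasurable)
    (by
      refine Eventually.of_forall fun θ hθ y hy => hC (y, θ) ⟨hy, ?_⟩
      rw [uIoc_of_le (by positivity)] at hθ
      exact ⟨hθ.1.le, hθ.2⟩)
    (by simp)
    (by
      refine Eventually.of_forall fun θ hθ y hy => ?_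
      have h1 : HasDerivAt (fun y : ℝ => 1 - y * Real.sin θ ^ 2) (-Real.sin θ ^ 2) y := by
        have := ((hasDerivAt_id y).mul_const (Real.sin θ ^ 2)).const_sub 1
        refine HasDerivAt.congr_deriv this ?_
        ring
      exact (h1.rpow_const (Or.inl (aux_pos (hlt y hy) θ).ne')).const_mul (g θ))
  have h2 := key.2
  have e : ∫ θ in (0:ℝ)..(π/2), F' x θ
      = -p * auxJ (p-1) (fun θ => g θ * Real.sin θ ^ 2) x := by
    unfold auxJ
    rw [← intervalIntegral.integral_const_mul]
    congr 1
    funext θ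
    simp only [hF']; ring
  rw [e] at h2
  exact h2

noncomputable def auxE : ℝ → ℝ := auxJ (1/2) (fun _ => 1)
noncomputable def auxK : ℝ → ℝ := auxJ (-1/2) (fun _ => 1)
noncomputable def auxQ : ℝ → ℝ := auxJ (-1/2) (fun θ => Real.sin θ ^ 2)

lemma ellE (r : ℝ) : ellipticE r = auxE (r^2) := by
  unfold ellipticE auxE auxJ
  simp [Real.sqrt_eq_rpow]

lemma ellK (r : ℝ) : ellipticK r = auxK (r^2) := by
  unfold ellipticK auxK auxJ
  simp

lemma auxQ_cont {x : ℝ} (hx : x < 1) : ContinuousAt auxQ x :=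
  (auxJ_deriv (-1/2) (g := fun θ => Real.sin θ ^ 2) (by fun_prop) hx).continuousAt

lemma auxE_eq {x : ℝ} (hx : x < 1) : auxE x = auxK x - x * auxQ x := by
  unfold auxE auxK auxQ auxJ
  rw [← intervalIntegral.integral_const_mul, ← intervalIntegral.integral_sub
    (aux_int hx _ continuous_const _ _) ((aux_int hx _ (by fun_prop) _ _).const_mul _)]
  congr 1
  funext θ
  have h := aux_pos hx θ
  have : (1 - x * Real.sin θ ^ 2) ^ (1/2:ℝ)
      = (1 - x * Real.sin θ ^ 2) * (1 - x * Real.sin θ ^ 2) ^ (-1/2:ℝ) := by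
    rw [← Real.rpow_one_add' h.le (by norm_num)]; norm_num
  rw [this]; ring

lemma auxE_deriv {x : ℝ} (hx : x < 1) : HasDerivAt auxE (-auxQ x / 2) x := by
  have := auxJ_deriv (1/2) (g := fun _ => 1) continuous_const hx
  refine HasDerivAt.congr_deriv this ?_
  unfold auxQ
  norm_num
  ring

lemma auxP_eq {x : ℝ} (hx : x < 1) :
    auxK x - auxQ x = auxJ (-1/2) (fun θ => Real.cos θ ^ 2) x := by
  unfold auxK auxQ auxJ
  rw [← intervalIntegral.integral_sub
    (aux_int hx _ continuous_const _ _) (aux_int hx _ (by fun_prop) _ _)]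
  congr 1
  funext θ
  linear_combination (-(1 - x * Real.sin θ ^ 2) ^ (-1 / 2:ℝ)) * Real.cos_sq' θ

lemma auxIBP {x : ℝ} (hx : x < 1) :
    auxK x - auxQ x = (1 - x) * auxJ (-1/2-1) (fun θ => 1 * Real.sin θ ^ 2) x := by
  rw [auxP_eq hx]
  have hd : ∀ θ ∈ uIcc (0:ℝ) (π/2), HasDerivAt
      (fun θ => Real.sin θ * Real.cos θ * (1 - x * Real.sin θ ^ 2) ^ (-1/2:ℝ))
      (Real.cos θ ^ 2 * (1 - x * Real.sin θ ^ 2) ^ (-1/2:ℝ)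
        - (1 - x) * (1 * Real.sin θ ^ 2 * (1 - x * Real.sin θ ^ 2) ^ (-1/2-1:ℝ))) θ := by
    intro θ _
    have h := aux_pos hx θ
    have h1 : HasDerivAt (fun θ : ℝ => 1 - x * Real.sin θ ^ 2)
        (-(x * (2 * Real.sin θ * Real.cos θ))) θ := by
      have := ((((Real.hasDerivAt_sin θ).pow 2).const_mul x).const_sub 1)
      refine HasDerivAt.congr_deriv this ?_
      simp
    have h2 := ((Real.hasDerivAt_sin θ).mul (Real.hasDerivAt_cos θ)).mul
      (h1.rpow_const (p := (-1/2:ℝ)) (Or.inl h.ne'))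
    refine HasDerivAt.congr_deriv h2 ?_
    have e : (1 - x * Real.sin θ ^ 2) ^ (-1/2:ℝ)
      = (1 - x * Real.sin θ ^ 2) * (1 - x * Real.sin θ ^ 2) ^ (-1/2-1:ℝ) := by
      rw [← Real.rpow_one_add' h.le (by norm_num)]; norm_num
    simp only [Pi.mul_apply]
    rw [e]
    have hc : Real.cos θ ^ 2 = 1 - Real.sin θ ^ 2 := Real.cos_sq' θ
    generalize (1 - x * Real.sin θ ^ 2) ^ (-1/2-1:ℝ) = Y
    generalize Real.sin θ = s at *
    generalize Real.cos θ = c at *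
    linear_combination (x*s^2*Y) * hc
  have hi := (aux_int hx (-1/2) (g := fun θ => Real.cos θ ^ 2) (by fun_prop) 0 (π/2))
  have hi2 := (aux_int hx (-1/2-1) (g := fun θ => 1 * Real.sin θ ^ 2) (by fun_prop) 0
    (π/2)).const_mul (1-x)
  have := intervalIntegral.integral_eq_sub_of_hasDerivAt hd (hi.sub hi2)
  rw [intervalIntegral.integral_sub hi hi2, intervalIntegral.integral_const_mul] at this
  simp only [Real.sin_zero, Real.cos_pi_div_two, mul_zero, zero_mul, sub_zero] at this
  unfold auxJ
  linarith

lemma auxK_deriv {x : ℝ} (hx : x < 1) :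
    HasDerivAt auxK ((auxK x - auxQ x) / (2 * (1 - x))) x := by
  have := auxJ_deriv (-1/2) (g := fun _ => 1) continuous_const hx
  refine HasDerivAt.congr_deriv this ?_
  rw [auxIBP hx]
  have : 1 - x ≠ 0 := by linarith
  field_simp

lemma auxQ_pos {x : ℝ} (hx : x < 1) : 0 < auxQ x := by
  refine intervalIntegral.intervalIntegral_pos_of_pos_on (aux_int hx _ (by fun_prop) _ _) ?_
    (by positivity)
  intro θ hθ
  have : 0 < Real.sin θ := Real.sin_pos_of_pos_of_lt_pi hθ.1 (by linarith [hθ.2, Real.pi_pos])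
  have := Real.rpow_pos_of_pos (aux_pos hx θ) (-1/2)
  positivity

lemma auxP_pos {x : ℝ} (hx : x < 1) : auxQ x < auxK x := by
  rw [← sub_pos, auxP_eq hx]
  refine intervalIntegral.intervalIntegral_pos_of_pos_on (aux_int hx _ (by fun_prop) _ _) ?_
    (by positivity)
  intro θ hθ
  have : 0 < Real.cos θ := Real.cos_pos_of_mem_Ioo ⟨by linarith [hθ.1, Real.pi_pos], hθ.2⟩
  have := Real.rpow_pos_of_pos (aux_pos hx θ) (-1/2)
  positivity

lemma auxK_zero : auxK 0 = π/2 := by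
  simp [auxK, auxJ]

lemma auxQ_zero : auxQ 0 = π/4 := by
  simp [auxQ, auxJ, integral_sin_sq]; ring

lemma aux_half {x : ℝ} (h0 : 0 < x) (hx : x < 1) : auxK x ≤ 2 * auxQ x := by
  have hd : ∀ y : ℝ, y < 1 → HasDerivAt (fun y => (2 - y) * auxK y - 2 * auxE y)
      ((auxK y - auxQ y) * y / (2 * (1 - y))) y := by
    intro y hy
    have := (((hasDerivAt_id y).const_sub 2).mul (auxK_deriv hy)).sub
      ((auxE_deriv hy).const_mul 2)
    refine HasDerivAt.congr_deriv this ?_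
    have : 1 - y ≠ 0 := by linarith
    simp only [id]
    field_simp
    ring
  have hm : MonotoneOn (fun y => (2 - y) * auxK y - 2 * auxE y) (Ico 0 1) := by
    refine monotoneOn_of_deriv_nonneg (convex_Ico 0 1) ?_ ?_ ?_
    · intro y hy; exact (hd y hy.2).continuousAt.continuousWithinAt
    · intro y hy; rw [interior_Ico] at hy
      exact (hd y hy.2).differentiableAt.differentiableWithinAt
    · intro y hy; rw [interior_Ico] at hy
      rw [(hd y hy.2).deriv]
      have := auxP_pos hy.2
      have h1 := hy.1
      have h2 := hy.2
      exact div_nonneg (mul_nonneg (by linarith) h1.le) (by linarith)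
  have := hm (show (0:ℝ) ∈ Ico (0:ℝ) 1 by simp) ⟨h0.le, hx⟩ h0.le
  simp only [auxE_eq hx, auxE_eq (show (0:ℝ) < 1 by norm_num)] at this
  nlinarith

lemma auxM_deriv {x : ℝ} (hx : x < 1) :
    HasDerivAt (fun x => auxE x ^ 2 - (1 - x) * auxK x ^ 2) (x * auxQ x ^ 2) x := by
  have := ((auxE_deriv hx).pow 2).sub
    (((hasDerivAt_id x).const_sub 1).mul ((auxK_deriv hx).pow 2))
  refine HasDerivAt.congr_deriv this ?_
  have : 1 - x ≠ 0 := by linarith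
  simp [auxE_eq hx]
  field_simp
  ring

lemma auxD_deriv {x : ℝ} (hx : x < 1) :
    HasDerivAt (fun x => auxE x - (1 - x) * auxK x) (auxK x / 2) x := by
  have := (auxE_deriv hx).sub
    (((hasDerivAt_id x).const_sub 1).mul (auxK_deriv hx))
  refine HasDerivAt.congr_deriv this ?_
  have : 1 - x ≠ 0 := by linarith
  simp
  field_simp
  ring

lemma auxM_zero : auxE 0 ^ 2 - (1 - 0) * auxK 0 ^ 2 = 0 := by
  rw [auxE_eq (by norm_num)]; ring

lemma auxM_pos {x : ℝ} (h0 : 0 < x) (hx : x < 1) : 0 < auxE x ^ 2 - (1 - x) * auxK x ^ 2 := by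
  have hm : StrictMonoOn (fun x => auxE x ^ 2 - (1 - x) * auxK x ^ 2) (Ico 0 1) := by
    refine strictMonoOn_of_deriv_pos (convex_Ico 0 1) ?_ ?_
    · intro y hy; exact (auxM_deriv hy.2).continuousAt.continuousWithinAt
    · intro y hy; rw [interior_Ico] at hy
      rw [(auxM_deriv hy.2).deriv]
      have := auxQ_pos hy.2
      have h1 := hy.1
      positivity
  have := hm (show (0:ℝ) ∈ Ico (0:ℝ) 1 by simp) ⟨h0.le, hx⟩ h0
  simp only [auxM_zero] at this
  exact this

lemma auxT_deriv {x : ℝ} (h0 : 0 < x) (hx : x < 1) :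
    HasDerivAt (fun x => 1 - auxE x / auxK x)
      ((x - 2 * (1 - auxE x / auxK x) * x + (1 - auxE x / auxK x) ^ 2) / (2 * x * (1 - x))) x := by
  have hK : auxK x ≠ 0 := by linarith [auxP_pos hx, auxQ_pos hx]
  have := ((auxE_deriv hx).div (auxK_deriv hx) hK).const_sub 1
  refine HasDerivAt.congr_deriv this ?_
  have : 1 - x ≠ 0 := by linarith
  rw [auxE_eq hx]
  field_simp
  ring

noncomputable def auxG (x : ℝ) : ℝ :=
  (x^2 - 2 * x * (1 - auxE x / auxK x) + (1 - auxE x / auxK x)^3) / (x * (1 - x))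

lemma auxG_deriv {x : ℝ} (h0 : 0 < x) (hx : x < 1) : ∃ d < 0, HasDerivAt auxG d x := by
  have hQ := auxQ_pos hx
  have hP := auxP_pos hx
  have hH := aux_half h0 hx
  have hK : 0 < auxK x := by linarith
  have h1 : 0 < 1 - x := by linarith
  have ht := auxT_deriv h0 hx
  have e : 1 - auxE x / auxK x = x * auxQ x / auxK x := by
    rw [auxE_eq hx]; field_simp; ring
  have b0 : 0 < 1 - auxE x / auxK x := by rw [e]; positivity
  have b1 : 1 - auxE x / auxK x < x := by
    rw [e, div_lt_iff₀ hK]; nlinarith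
  have b2 : x ≤ 2 * (1 - auxE x / auxK x) := by
    rw [e, mul_div_assoc', le_div_iff₀ hK]; nlinarith
  have hn := ((((hasDerivAt_id x).pow 2).sub (((hasDerivAt_id x).const_mul 2).mul ht)).add
    (ht.pow 3)).div ((hasDerivAt_id x).mul ((hasDerivAt_id x).const_sub 1))
    (by simp; constructor <;> linarith)
  refine ⟨_, ?_, hn⟩
  simp only [id, Pi.mul_apply, Pi.pow_apply, Pi.sub_apply, Pi.add_apply]
  generalize 1 - auxE x / auxK x = t at *
  have hL : x * (1 - 2 * t) - 2 * t + 3 * t^2 < 0 := by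
    rcases le_or_gt t (1/2) with h | h
    · nlinarith
    · nlinarith
  apply div_neg_of_neg_of_pos _ (by positivity)
  have : 0 < -(t^2 * (x * (1 - 2 * t) - 2 * t + 3 * t^2) / 2) := by
    have : t^2 * (x * (1 - 2 * t) - 2 * t + 3 * t^2) < 0 :=
      mul_neg_of_pos_of_neg (by positivity) hL
    linarith
  refine lt_of_eq_of_lt ?_ (neg_neg_of_pos this)
  push_cast
  field_simp
  ring

lemma auxG_cont : ContinuousOn auxG (Ico 0 1) := by
  have hc : ContinuousOn (fun x => x * (1 - 2 * (auxQ x / auxK x) + x * (auxQ x / auxK x)^3)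
      / (1 - x)) (Ico 0 1) := by
    have hQ : ContinuousOn auxQ (Ico 0 1) := fun y hy => (auxQ_cont hy.2).continuousWithinAt
    have hK : ContinuousOn auxK (Ico 0 1) :=
      fun y hy => (auxK_deriv hy.2).continuousAt.continuousWithinAt
    have hR : ContinuousOn (fun x => auxQ x / auxK x) (Ico 0 1) :=
      hQ.div hK fun y hy => by linarith [auxP_pos hy.2, auxQ_pos hy.2]
    refine ContinuousOn.div (by fun_prop) (by fun_prop) ?_
    intro y hy; linarith [hy.2]
  refine hc.congr ?_
  intro x hx
  have hK : auxK x ≠ 0 := by linarith [auxP_pos hx.2, auxQ_pos hx.2]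
  have h1 : 1 - x ≠ 0 := by linarith [hx.2]
  rcases hx.1.eq_or_lt with h | h
  · subst h; simp [auxG]
  · simp only [auxG]
    rw [auxE_eq hx.2]
    have e : 1 - (auxK x - x * auxQ x) / auxK x = x * (auxQ x / auxK x) := by
      field_simp; ring
    rw [e]
    have := h.ne'
    generalize auxQ x / auxK x = t
    field_simp

lemma auxG_neg {x : ℝ} (h0 : 0 < x) (hx : x < 1) : auxG x < 0 := by
  have hm : StrictAntiOn auxG (Ico 0 1) := by
    refine strictAntiOn_of_deriv_neg (convex_Ico 0 1) auxG_cont ?_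
    intro y hy; rw [interior_Ico] at hy
    obtain ⟨d, hd, h⟩ := auxG_deriv hy.1 hy.2
    rwa [h.deriv]
  have := hm (show (0:ℝ) ∈ Ico (0:ℝ) 1 by simp) ⟨h0.le, hx⟩ h0
  simpa [auxG] using this

lemma aux_phi {x : ℝ} (h0 : 0 < x) (hx : x < 1) :
    auxK x ^ 3 - 2 * auxQ x * auxK x ^ 2 + x * auxQ x ^ 3 < 0 := by
  have hK : 0 < auxK x := by linarith [auxP_pos hx, auxQ_pos hx]
  have h1 : 0 < 1 - x := by linarith
  have e : auxG x = (auxK x ^ 3 - 2 * auxQ x * auxK x ^ 2 + x * auxQ x ^ 3) *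
      (x / ((1 - x) * auxK x ^ 3)) := by
    simp only [auxG]
    rw [auxE_eq hx]
    field_simp
    ring
  have h := auxG_neg h0 hx
  rw [e] at h
  exact neg_of_mul_neg_left h (by positivity)

noncomputable def auxF (x : ℝ) : ℝ :=
  (auxE x - (1 - x) * auxK x)^2 / (auxE x ^ 2 - (1 - x) * auxK x ^ 2)

lemma auxN_deriv {x : ℝ} (hx : x < 1) :
    HasDerivAt (fun x => (auxE x - (1 - x) * auxK x)^2) (x * (auxK x - auxQ x) * auxK x) x := by
  have := (auxD_deriv hx).pow 2
  refine HasDerivAt.congr_deriv this ?_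
  rw [auxE_eq hx]
  simp
  ring

lemma auxF_anti : StrictAntiOn auxF (Ioo 0 1) := by
  have hd : ∀ x ∈ Ioo (0:ℝ) 1, ∃ d < 0, HasDerivAt auxF d x := by
    intro x hx
    have hM := auxM_pos hx.1 hx.2
    refine ⟨_, ?_, (auxN_deriv hx.2).div (auxM_deriv hx.2) hM.ne'⟩
    refine div_neg_of_neg_of_pos ?_ (by positivity)
    have hphi := aux_phi hx.1 hx.2
    have h0 := hx.1
    have hP := auxP_pos hx.2
    rw [auxE_eq hx.2]
    have : 0 < x^2 * (auxK x - auxQ x) := by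
      have : 0 < auxK x - auxQ x := by linarith
      positivity
    have := mul_neg_of_pos_of_neg this hphi
    refine lt_of_eq_of_lt ?_ this
    ring
  refine strictAntiOn_of_deriv_neg (convex_Ioo 0 1) ?_ ?_
  · intro x hx
    obtain ⟨d, _, h⟩ := hd x hx
    exact h.continuousAt.continuousWithinAt
  · intro x hx
    rw [interior_Ioo] at hx
    obtain ⟨d, hd, h⟩ := hd x hx
    rwa [h.deriv]

lemma auxF_zero : Tendsto auxF (𝓝[>] 0) (𝓝 2) := by
  have hev : ∀ᶠ x : ℝ in 𝓝[>] 0, x ∈ Ioo (0:ℝ) 1 := Ioo_mem_nhdsGT (by norm_num)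
  have h01 : (0:ℝ) < 1 := by norm_num
  refine HasDerivAt.lhopital_zero_nhdsGT (f' := fun x => x * (auxK x - auxQ x) * auxK x)
    (g' := fun x => x * auxQ x ^ 2) ?_ ?_ ?_ ?_ ?_ ?_
  · filter_upwards [hev] with x hx using auxN_deriv hx.2
  · filter_upwards [hev] with x hx using auxM_deriv hx.2
  · filter_upwards [hev] with x hx
    have := auxQ_pos hx.2
    have := hx.1
    positivity
  · have := (auxN_deriv h01).continuousAt.tendsto
    simp only [auxE_eq h01] at this
    refine (this.mono_left nhdsWithin_le_nhds).trans (le_of_eq ?_)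
    ring_nf
  · have := (auxM_deriv h01).continuousAt.tendsto
    simp only [auxM_zero] at this
    exact this.mono_left nhdsWithin_le_nhds
  · have hc : ContinuousAt (fun x => (auxK x - auxQ x) * auxK x / auxQ x ^ 2) 0 := by
      have hK := (auxK_deriv h01).continuousAt
      have hQ := auxQ_cont h01
      exact ((hK.sub hQ).mul hK).div (hQ.pow 2) (pow_pos (auxQ_pos h01) 2).ne'
    have := hc.tendsto
    have e : (auxK 0 - auxQ 0) * auxK 0 / auxQ 0 ^ 2 = 2 := by
      rw [auxK_zero, auxQ_zero]
      have := Real.pi_pos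
      field_simp
      norm_num
    rw [e] at this
    refine (this.mono_left nhdsWithin_le_nhds).congr' ?_
    filter_upwards [hev] with x hx
    have := auxQ_pos hx.2
    have := hx.1
    field_simp

lemma auxE_one : Tendsto auxE (𝓝[<] 1) (𝓝 1) := by
  have e : ∫ θ in (0:ℝ)..(π/2), Real.cos θ = 1 := by simp
  suffices Tendsto auxE (𝓝[<] 1) (𝓝 (∫ θ in (0:ℝ)..(π/2), Real.cos θ)) by rwa [e] at this
  unfold auxE auxJ
  have hev : ∀ᶠ x : ℝ in 𝓝[<] 1, x ∈ Ioo (0:ℝ) 1 := Ioo_mem_nhdsLT (by norm_num)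
  refine intervalIntegral.tendsto_integral_filter_of_dominated_convergence (fun _ => 1) ?_ ?_ ?_ ?_
  · filter_upwards [hev] with x hx
    exact (aux_cont hx.2 _ continuous_const).aestronglyMeasurable
  · filter_upwards [hev] with x hx
    refine Eventually.of_forall fun θ _ => ?_
    have h := aux_pos hx.2 θ
    rw [one_mul, Real.norm_of_nonneg (by positivity)]
    refine Real.rpow_le_one h.le ?_ (by norm_num)
    have := hx.1
    nlinarith [sq_nonneg (Real.sin θ)]
  · simp
  · refine Eventually.of_forall fun θ hθ => ?_
    rw [uIoc_of_le (by positivity)] at hθ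
    have hc : Continuous (fun x : ℝ => 1 * (1 - x * Real.sin θ ^ 2) ^ (1/2:ℝ)) :=
      continuous_const.mul (Continuous.rpow_const (by fun_prop) (fun _ => Or.inr (by norm_num)))
    have := (hc.tendsto 1).mono_left (nhdsWithin_le_nhds (s := Iio 1))
    refine this.trans (le_of_eq ?_)
    have hcos : 0 ≤ Real.cos θ := Real.cos_nonneg_of_mem_Icc ⟨by linarith [hθ.1, Real.pi_pos], hθ.2⟩
    rw [one_mul, one_mul, ← Real.cos_sq', ← Real.sqrt_eq_rpow, Real.sqrt_sq hcos]

lemma auxK_one : Tendsto (fun x => (1 - x) ^ (1/2:ℝ) * auxK x) (𝓝[<] 1) (𝓝 0) := by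
  have e : ∫ θ in (0:ℝ)..(π/2), (0:ℝ) = 0 := by simp
  rw [← e]
  unfold auxK auxJ
  simp only [← intervalIntegral.integral_const_mul]
  have hev : ∀ᶠ x : ℝ in 𝓝[<] 1, x ∈ Ioo (0:ℝ) 1 := Ioo_mem_nhdsLT (by norm_num)
  refine intervalIntegral.tendsto_integral_filter_of_dominated_convergence (fun _ => 1) ?_ ?_ ?_ ?_
  · filter_upwards [hev] with x hx
    exact ((aux_cont hx.2 _ continuous_const).const_mul _).aestronglyMeasurable
  · filter_upwards [hev] with x hx
    refine Eventually.of_forall fun θ _ => ?_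
    have h := aux_pos hx.2 θ
    have h1 : 0 < 1 - x := by linarith [hx.2]
    rw [one_mul, Real.norm_of_nonneg (by positivity)]
    rw [show (-1/2:ℝ) = -(1/2) by norm_num, Real.rpow_neg h.le, ← div_eq_mul_inv,
      div_le_one (by positivity)]
    refine Real.rpow_le_rpow h1.le ?_ (by norm_num)
    have := hx.1
    nlinarith [Real.sin_sq_le_one θ]
  · simp
  · have hne : ∀ᵐ θ : ℝ, θ ≠ π/2 := by simp [MeasureTheory.ae_iff]
    filter_upwards [hne] with θ hθn hθ
    rw [uIoc_of_le (by positivity)] at hθ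
    have hcos : 0 < Real.cos θ :=
      Real.cos_pos_of_mem_Ioo ⟨by linarith [hθ.1, Real.pi_pos], lt_of_le_of_ne hθ.2 hθn⟩
    have hc : ContinuousAt (fun x : ℝ => (1 - x) ^ (1/2:ℝ) *
        (1 * (1 - x * Real.sin θ ^ 2) ^ (-1/2:ℝ))) 1 := by
      refine ContinuousAt.mul (ContinuousAt.rpow_const (by fun_prop) (Or.inr (by norm_num)))
        (continuousAt_const.mul (ContinuousAt.rpow_const (by fun_prop) (Or.inl ?_)))
      rw [one_mul, ← Real.cos_sq']; positivity
    have := hc.tendsto.mono_left (nhdsWithin_le_nhds (s := Iio 1))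
    refine this.trans (le_of_eq ?_)
    norm_num

lemma auxF_one : Tendsto auxF (𝓝[<] 1) (𝓝 1) := by
  have hev : ∀ᶠ x : ℝ in 𝓝[<] 1, x ∈ Ioo (0:ℝ) 1 := Ioo_mem_nhdsLT (by norm_num)
  have hr : Tendsto (fun x : ℝ => (1 - x) ^ (1/2:ℝ)) (𝓝[<] 1) (𝓝 0) := by
    have hc : Continuous (fun x : ℝ => (1 - x) ^ (1/2:ℝ)) :=
      Continuous.rpow_const (by fun_prop) (fun _ => Or.inr (by norm_num))
    refine ((hc.tendsto 1).mono_left nhdsWithin_le_nhds).trans (le_of_eq ?_)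
    norm_num
  have h := ((auxE_one.sub (hr.mul auxK_one)).pow 2).div
    ((auxE_one.pow 2).sub (auxK_one.pow 2)) (by norm_num)
  norm_num at h
  refine h.congr' ?_
  filter_upwards [hev] with x hx
  have h1 : 0 < 1 - x := by linarith [hx.2]
  have e : (1 - x) ^ (1/2:ℝ) * (1 - x) ^ (1/2:ℝ) = 1 - x := by
    rw [← Real.rpow_add h1]; norm_num
  simp only [auxF, Pi.div_apply]
  rw [mul_pow, sq ((1-x)^(1/2:ℝ)), ← mul_assoc, e]

/-- Lemma 2.2(6): r ↦ (E − r'²K)²/(E² − r'²K²) is strictly decreasing from (0,1) onto (1, 2). -/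
theorem stmt_7 :
    StrictAntiOn
      (fun r : ℝ => (ellipticE r - (1 - r^2) * ellipticK r)^2 /
        (ellipticE r ^ 2 - (1 - r^2) * ellipticK r ^ 2)) (Ioo 0 1) ∧
    Tendsto (fun r : ℝ => (ellipticE r - (1 - r^2) * ellipticK r)^2 /
        (ellipticE r ^ 2 - (1 - r^2) * ellipticK r ^ 2))
      (𝓝[>] 0) (𝓝 2) ∧
    Tendsto (fun r : ℝ => (ellipticE r - (1 - r^2) * ellipticK r)^2 /
        (ellipticE r ^ 2 - (1 - r^2) * ellipticK r ^ 2))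
      (𝓝[<] 1) (𝓝 1) := by
  have e : (fun r : ℝ => (ellipticE r - (1 - r^2) * ellipticK r)^2 /
        (ellipticE r ^ 2 - (1 - r^2) * ellipticK r ^ 2)) = fun r => auxF (r^2) := by
    funext r
    rw [ellE, ellK, auxF]
  rw [e]
  have hmem : ∀ r ∈ Ioo (0:ℝ) 1, r^2 ∈ Ioo (0:ℝ) 1 := by
    intro r hr
    have h0 := hr.1
    have h1 := hr.2
    exact ⟨by positivity, by nlinarith⟩
  refine ⟨?_, ?_, ?_⟩
  · intro a ha b hb hab
    refine auxF_anti (hmem a ha) (hmem b hb) ?_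
    have := ha.1
    nlinarith
  · refine auxF_zero.comp (tendsto_nhdsWithin_iff.2 ⟨?_, ?_⟩)
    · have : Continuous (fun r : ℝ => r^2) := by fun_prop
      refine ((this.tendsto 0).mono_left nhdsWithin_le_nhds).trans (le_of_eq ?_)
      norm_num
    · filter_upwards [Ioo_mem_nhdsGT (show (0:ℝ) < 1 by norm_num)] with r hr using (hmem r hr).1
  · refine auxF_one.comp (tendsto_nhdsWithin_iff.2 ⟨?_, ?_⟩)
    · have : Continuous (fun r : ℝ => r^2) := by fun_prop
      refine ((this.tendsto 1).mono_left nhdsWithin_le_nhds).trans (le_of_eq ?_)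
      norm_num
    · filter_upwards [Ioo_mem_nhdsLT (show (0:ℝ) < 1 by norm_num)] with r hr using (hmem r hr).2
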